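/- arXiv:2407.04626 — 8 statements merged into one kernel-verified Lean document; each statement's English description precedes it below -/
import Mathlib

section
/- Let Λ ⊆ ℤ^d be a subgroup of rank r and let s ∈ {1,…,r}. Then the group of diagonal matrices {Δ(g) : g ∈ H_Λ} ⊆ GL_d(ℚ̄) is s-generated (i.e., equals cl⟨M_1,…,M_s⟩ for some matrices M_1,…,M_s ∈ GL_d(ℚ̄), not necessarily distinct) if and only if the torsion subgroup of ℤ^d/Λ can be generated by s elements. -/
open Matrix MvPolynomial

noncomputable section

abbrev Qbar : Type := AlgebraicClosure ℚ

/-- Zariski closure of a subset of `Qbar^ι`: the common zero set of all polynomials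
vanishing on `E`. -/
def zcl {ι : Type} [Fintype ι] (E : Set (ι → Qbar)) : Set (ι → Qbar) :=
  {x | ∀ p : MvPolynomial ι Qbar, (∀ y ∈ E, eval y p = 0) → eval x p = 0}

/-- Zariski closure of a set of `d × d` matrices over `Qbar` (matrices identified with
points of `Qbar^(d²)`). -/
def mcl {d : ℕ} (E : Set (Matrix (Fin d) (Fin d) Qbar)) : Set (Matrix (Fin d) (Fin d) Qbar) :=
  {A | ∀ p : MvPolynomial (Fin d × Fin d) Qbar,
      (∀ B ∈ E, eval (fun ij => B ij.1 ij.2) p = 0) → eval (fun ij => A ij.1 ij.2) p = 0}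

/-- `cl⟨S⟩`: the group topologically generated by `S ⊆ GL_d(Qbar)`, i.e.
`GL_d(Qbar) ∩ cl(⟨S⟩)` where `⟨S⟩` is the subgroup generated by `S`. -/
def topcl {d : ℕ} (S : Set (GL (Fin d) Qbar)) : Set (GL (Fin d) Qbar) :=
  {g | (g : Matrix (Fin d) (Fin d) Qbar) ∈
      mcl ((fun h : GL (Fin d) Qbar => (h : Matrix (Fin d) (Fin d) Qbar)) ''
        ((Subgroup.closure S : Subgroup (GL (Fin d) Qbar)) : Set (GL (Fin d) Qbar)))}

/-- `H_Λ = {x ∈ (Qbarˣ)^d : x₁^{v₁} ⋯ x_d^{v_d} = 1 for all v ∈ Λ}`. -/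
def HLat {d : ℕ} (Λ : Submodule ℤ (Fin d → ℤ)) : Set (Fin d → Qbarˣ) :=
  {x | ∀ v ∈ Λ, ∏ i, x i ^ v i = 1}

section CharacterTheory

variable {G : Type*} [CommGroup G]

/-- Characters of a finite abelian group generate its dual iff they separate points. -/
lemma closure_range_characters_eq_top_iff [Finite G] {ι : Type*} (φ : ι → G →* Qbarˣ) :
    Subgroup.closure (Set.range φ) = ⊤ ↔ ∀ g, (∀ i, φ i g = 1) → g = 1 := by
  have : NeZero (Monoid.exponent G) := ⟨Monoid.exponent_ne_zero_of_finite⟩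
  have hdual : HasEnoughRootsOfUnity Qbar (Monoid.exponent (G →* Qbarˣ)) := by
    rw [Monoid.exponent_eq_of_mulEquiv
      (CommGroup.monoidHom_mulEquiv_of_hasEnoughRootsOfUnity G Qbar).some]
    infer_instance
  have hfin : Finite (G →* Qbarˣ) :=
    (CommGroup.monoidHom_mulEquiv_of_hasEnoughRootsOfUnity G Qbar).some.finite_iff.mpr ‹_›
  constructor
  · intro h g hg
    by_contra hne
    obtain ⟨ψ, hψ⟩ := CommGroup.exists_apply_ne_one_of_hasEnoughRootsOfUnity G Qbar hne
    have hle : Subgroup.closure (Set.range φ) ≤ (MonoidHom.eval g : (G →* Qbarˣ) →* Qbarˣ).ker := by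
      rw [Subgroup.closure_le]
      rintro _ ⟨i, rfl⟩
      exact hg i
    exact hψ (hle (h ▸ Subgroup.mem_top ψ))
  · intro h
    refine (Subgroup.eq_top_iff' _).mpr fun ψ => ?_
    rw [← CommGroup.forall_monoidHom_apply_eq_one_iff (M := Qbar)]
    intro η hη
    have hη' := CommGroup.apply_monoidHomMonoidHomEquiv (G := G) (M := Qbar) (η := η)
    have : CommGroup.monoidHomMonoidHomEquiv G Qbar η = 1 :=
      h _ fun i => by rw [hη', hη _ (Subgroup.subset_closure ⟨i, rfl⟩)]
    rw [← hη', this, map_one]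

lemma exists_separating_characters_iff [Finite G] {ι : Type*} :
    (∃ φ : ι → G →* Qbarˣ, ∀ g, (∀ i, φ i g = 1) → g = 1) ↔
      ∃ t : ι → G, Subgroup.closure (Set.range t) = ⊤ := by
  have : NeZero (Monoid.exponent G) := ⟨Monoid.exponent_ne_zero_of_finite⟩
  obtain ⟨e⟩ := CommGroup.monoidHom_mulEquiv_of_hasEnoughRootsOfUnity G Qbar
  simp_rw [← closure_range_characters_eq_top_iff]
  constructor
  · rintro ⟨φ, hφ⟩
    refine ⟨e ∘ φ, ?_⟩
    rw [Set.range_comp]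
    exact (MonoidHom.map_closure e.toMonoidHom _).symm.trans
      (hφ ▸ Subgroup.map_top_of_surjective _ e.surjective)
  · rintro ⟨t, ht⟩
    refine ⟨e.symm ∘ t, ?_⟩
    rw [Set.range_comp]
    exact (MonoidHom.map_closure e.symm.toMonoidHom _).symm.trans
      (ht ▸ Subgroup.map_top_of_surjective _ e.symm.surjective)

/-- A linear relation between characters persists for any values that depend only on the
character. -/
lemma sum_eq_zero_of_characters {G ι : Type*} [Group G] (S : Finset ι) (χ : ι → G →* Qbar)
    (c y : ι → Qbar) (h : ∀ g, ∑ i ∈ S, c i * χ i g = 0)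
    (hy : ∀ i j, χ i = χ j → y i = y j) : ∑ i ∈ S, c i * y i = 0 := by
  classical
  have hmaps : ∀ i ∈ S, χ i ∈ S.image χ := fun i hi => Finset.mem_image_of_mem χ hi
  have key : ∀ ψ ∈ S.image χ, ∑ i ∈ S with χ i = ψ, c i = 0 := by
    refine linearIndependent_iff'.mp (linearIndependent_monoidHom G Qbar) _ _ ?_
    funext g
    rw [Finset.sum_apply, Pi.zero_apply, ← h g, ← Finset.sum_fiberwise_of_maps_to hmaps]
    refine Finset.sum_congr rfl fun ψ _ => ?_
    rw [Pi.smul_apply, smul_eq_mul, Finset.sum_mul]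
    refine Finset.sum_congr rfl fun i hi => ?_
    rw [(Finset.mem_filter.mp hi).2]
  rw [← Finset.sum_fiberwise_of_maps_to hmaps]
  refine Finset.sum_eq_zero fun ψ hψ => ?_
  obtain ⟨j, -, rfl⟩ := Finset.mem_image.mp hψ
  calc ∑ i ∈ S with χ i = χ j, c i * y i = ∑ i ∈ S with χ i = χ j, c i * y j :=
        Finset.sum_congr rfl fun i hi => by rw [hy i j (Finset.mem_filter.mp hi).2]
    _ = 0 := by rw [← Finset.sum_mul, key _ hψ, zero_mul]

end CharacterTheory

section FinitelyGenerated

/-- Distinct primes are multiplicatively independent in `Qbarˣ`. -/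
lemma exists_injective_monoidHom_of_free (F : Type*) [AddCommGroup F] [Module.Free ℤ F]
    [Module.Finite ℤ F] : ∃ ρ : Multiplicative F →* Qbarˣ, Function.Injective ρ := by
  let b := Module.finBasis ℤ F
  let p : ℕ → ℚˣ := fun j => Units.mk0 (Nat.nth Nat.Prime j : ℚ)
    (by exact_mod_cast (Nat.prime_nth_prime j).ne_zero)
  let ρ₀ : Multiplicative F →* ℚˣ :=
    { toFun := fun a => ∏ j : Fin _, p j ^ b.repr a.toAdd j
      map_one' := by simp
      map_mul' := fun x y => by simp [_root_.zpow_add, Finset.prod_mul_distrib] }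
  refine ⟨(Units.map (algebraMap ℚ Qbar : ℚ →* Qbar)).comp ρ₀,
    (Units.map_injective (algebraMap ℚ Qbar).injective).comp ?_⟩
  rw [injective_iff_map_eq_one]
  intro a ha
  suffices b.repr a.toAdd = 0 from congrArg Multiplicative.ofAdd (b.repr.map_eq_zero_iff.mp this)
  ext k
  have : Fact (Nat.nth Nat.Prime k).Prime := ⟨Nat.prime_nth_prime k⟩
  let v : ℚˣ →* Multiplicative ℤ :=
    { toFun := fun x => Multiplicative.ofAdd (padicValRat (Nat.nth Nat.Prime k) x)
      map_one' := by simp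
      map_mul' := fun x y => by simp [padicValRat.mul, ofAdd_add] }
  have hv : ∀ j, v (p j) = if j = k then Multiplicative.ofAdd 1 else 1 := by
    intro j
    have : Fact (Nat.nth Nat.Prime j).Prime := ⟨Nat.prime_nth_prime j⟩
    split_ifs with hjk
    · subst hjk; simp [v, p]
    · have : Nat.nth Nat.Prime k ≠ Nat.nth Nat.Prime j := fun h =>
        hjk (Nat.nth_injective Nat.infinite_setOfPred_prime h).symm
      simp [v, p, padicValNat_primes this]
  have := congrArg v ha
  simp only [ρ₀, MonoidHom.coe_mk, OneHom.coe_mk, map_prod, map_zpow, hv, map_one] at this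
  rw [Finset.prod_eq_single k (fun j _ hj => by simp [Fin.val_injective.ne hj]) (by simp)] at this
  simpa [← ofAdd_zsmul] using! this

variable (A : Type*) [AddCommGroup A] [Module.Finite ℤ A]

lemma exists_retraction_torsion :
    ∃ π : A →ₗ[ℤ] Submodule.torsion ℤ A, ∀ t : Submodule.torsion ℤ A, π t = t := by
  obtain ⟨σ, hσ⟩ := (Submodule.torsion ℤ A).mkQ.exists_rightInverse_of_surjective
    (Submodule.range_mkQ _)
  have hmem : ∀ a, a - σ ((Submodule.torsion ℤ A).mkQ a) ∈ Submodule.torsion ℤ A := fun a => by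
    refine (Submodule.Quotient.eq (Submodule.torsion ℤ A)).mp ?_
    exact (LinearMap.congr_fun hσ _).symm
  refine ⟨(LinearMap.id - σ.comp (Submodule.mkQ _)).codRestrict _ hmem, fun t => ?_⟩
  ext
  simp [(Submodule.Quotient.mk_eq_zero (Submodule.torsion ℤ A)).mpr t.2]

instance : Finite (Submodule.torsion ℤ A) :=
  Module.finite_of_fg_torsion _ (Submodule.torsion_isTorsion)

lemma exists_span_eq_top_iff {T ι : Type*} [AddCommGroup T] :
    (∃ t : ι → T, Submodule.span ℤ (Set.range t) = ⊤) ↔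
      ∃ t : ι → Multiplicative T, Subgroup.closure (Set.range t) = ⊤ := by
  refine exists_congr fun t => ?_
  rw [← Submodule.toAddSubgroup_injective.eq_iff, Submodule.span_int_eq_addSubgroupClosure,
    ← AddSubgroup.toSubgroup.injective.eq_iff]
  exact Iff.of_eq (congrArg (· = _) (AddSubgroup.toSubgroup_closure _))

/-- The torsion of a finitely generated abelian group is generated by a nonempty family of size
`ι` iff the group admits a separating family of characters of size `ι`. -/
lemma exists_span_torsion_eq_top_iff {ι : Type*} [Nonempty ι] :
    (∃ t : ι → Submodule.torsion ℤ A, Submodule.span ℤ (Set.range t) = ⊤) ↔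
      ∃ φ : ι → Multiplicative A →* Qbarˣ, ∀ a, (∀ i, φ i a = 1) → a = 1 := by
  classical
  have : Finite (Multiplicative (Submodule.torsion ℤ A)) :=
    inferInstanceAs (Finite (Submodule.torsion ℤ A))
  rw [exists_span_eq_top_iff, ← exists_separating_characters_iff]
  constructor
  · rintro ⟨φ, hφ⟩
    obtain ⟨π, hπ⟩ := exists_retraction_torsion A
    obtain ⟨ρ, hρ⟩ := exists_injective_monoidHom_of_free (A ⧸ Submodule.torsion ℤ A)
    let q : Multiplicative A →* Multiplicative (A ⧸ Submodule.torsion ℤ A) :=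
      AddMonoidHom.toMultiplicative (Submodule.torsion ℤ A).mkQ.toAddMonoidHom
    let π' : Multiplicative A →* Multiplicative (Submodule.torsion ℤ A) :=
      AddMonoidHom.toMultiplicative π.toAddMonoidHom
    let i₀ : ι := Classical.arbitrary ι
    refine ⟨fun i => (φ i).comp π' * if i = i₀ then ρ.comp q else 1, fun a ha => ?_⟩
    obtain ⟨n, hn, hn'⟩ : ∃ n : ℕ, 0 < n ∧ π' a ^ n = 1 :=
      ⟨_, Nat.card_pos, pow_card_eq_one'⟩
    have hq : q a ^ n = 1 := by
      have := congrArg (· ^ n) (ha i₀)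
      simp only [if_pos, MonoidHom.mul_apply, MonoidHom.comp_apply, mul_pow, one_pow] at this
      rw [← map_pow (φ i₀), ← map_pow ρ, hn', map_one, one_mul] at this
      exact hρ (this.trans (map_one ρ).symm)
    have hq1 : q a = 1 := by
      have : (n : ℤ) • (q a).toAdd = 0 := by
        simpa using congrArg Multiplicative.toAdd hq
      exact congrArg Multiplicative.ofAdd ((smul_eq_zero_iff_right (by positivity)).mp this)
    have hmem : a.toAdd ∈ Submodule.torsion ℤ A :=
      (Submodule.Quotient.mk_eq_zero _).mp hq1
    have hπ1 : π' a = 1 := hφ _ fun i => by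
      have := ha i
      dsimp only at this
      split_ifs at this <;> simpa [hq1] using this
    have := (hπ ⟨_, hmem⟩).symm.trans (congrArg Multiplicative.toAdd hπ1)
    exact congrArg Multiplicative.ofAdd (congrArg Subtype.val this)
  · rintro ⟨φ, hφ⟩
    let j : Multiplicative (Submodule.torsion ℤ A) →* Multiplicative A :=
      AddMonoidHom.toMultiplicative (Submodule.torsion ℤ A).subtype.toAddMonoidHom
    refine ⟨fun i => (φ i).comp j, fun g hg => ?_⟩
    exact congrArg Multiplicative.ofAdd (Subtype.ext (congrArg Multiplicative.toAdd (hφ _ hg)))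

/-- Characters separate the points of a finitely generated abelian group. -/
lemma eq_one_of_forall_character (a : Multiplicative A)
    (ha : ∀ φ : Multiplicative A →* Qbarˣ, φ a = 1) : a = 1 := by
  obtain ⟨φ, hφ⟩ := (exists_span_torsion_eq_top_iff A (ι := Submodule.torsion ℤ A)).mp
    ⟨id, by simp⟩
  exact hφ a fun i => ha _

end FinitelyGenerated

section Diagonal

variable {d : ℕ}

/-- The embedding of the torus into `GL_d` as diagonal matrices. -/
def diagHom (d : ℕ) : (Fin d → Qbarˣ) →* GL (Fin d) Qbar :=
  (Units.map (Matrix.diagonalRingHom (Fin d) Qbar).toMonoidHom).comp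
    (MulEquiv.piUnits (M := fun _ : Fin d => Qbar)).symm.toMonoidHom

lemma coe_diagHom (x : Fin d → Qbarˣ) :
    (diagHom d x : Matrix (Fin d) (Fin d) Qbar) = Matrix.diagonal fun i => (x i : Qbar) := rfl

lemma setOf_diagonal_eq_image (Λ : Submodule ℤ (Fin d → ℤ)) :
    {A : GL (Fin d) Qbar | ∃ g ∈ HLat Λ,
      (A : Matrix (Fin d) (Fin d) Qbar) = Matrix.diagonal (fun i => (g i : Qbar))} =
      diagHom d '' HLat Λ := by
  ext A
  exact exists_congr fun g => and_congr_right fun _ =>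
    ⟨fun h => (Units.ext h).symm, fun h => h ▸ coe_diagHom g⟩

/-- The character of the torus with exponent vector `v`. -/
def torusChar (v : Fin d → ℤ) : (Fin d → Qbarˣ) →* Qbarˣ where
  toFun x := ∏ i, x i ^ v i
  map_one' := by simp
  map_mul' x y := by simp [mul_zpow, Finset.prod_mul_distrib]

lemma torusChar_apply (v : Fin d → ℤ) (x : Fin d → Qbarˣ) : torusChar v x = ∏ i, x i ^ v i := rfl

lemma torusChar_sub (v w : Fin d → ℤ) (x : Fin d → Qbarˣ) :
    torusChar (v - w) x = torusChar v x / torusChar w x := by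
  simp only [torusChar_apply, Pi.sub_apply, _root_.zpow_sub, ← div_eq_mul_inv,
    Finset.prod_div_distrib]

lemma torusChar_eq_character {Λ : Submodule ℤ (Fin d → ℤ)}
    (f : Multiplicative ((Fin d → ℤ) ⧸ Λ) →* Qbarˣ) (v : Fin d → ℤ) :
    torusChar v (fun i => f (Multiplicative.ofAdd (Λ.mkQ (Pi.single i 1)))) =
      f (Multiplicative.ofAdd (Λ.mkQ v)) := by
  rw [torusChar_apply]
  conv_rhs => rw [← Finset.univ_sum_single v, map_sum, ofAdd_sum, map_prod]
  refine Finset.prod_congr rfl fun i _ => ?_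
  rw [← map_zpow, ← ofAdd_zsmul, ← map_zsmul, ← Pi.single_smul]
  simp

lemma exists_character_of_mem_HLat {Λ : Submodule ℤ (Fin d → ℤ)} {x : Fin d → Qbarˣ}
    (hx : x ∈ HLat Λ) : ∃ f : Multiplicative ((Fin d → ℤ) ⧸ Λ) →* Qbarˣ,
      ∀ v, f (Multiplicative.ofAdd (Λ.mkQ v)) = torusChar v x := by
  let χ : (Fin d → ℤ) →+ Additive Qbarˣ :=
    { toFun := fun v => Additive.ofMul (torusChar v x)
      map_zero' := by simp [torusChar_apply]
      map_add' := fun v w => by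
        simp [torusChar_apply, _root_.zpow_add, Finset.prod_mul_distrib, ofMul_mul] }
  let f : ((Fin d → ℤ) ⧸ Λ) →ₗ[ℤ] Additive Qbarˣ :=
    Λ.liftQ χ.toIntLinearMap fun v hv => hx v hv
  exact ⟨AddMonoidHom.toMultiplicativeLeft f.toAddMonoidHom, fun v => rfl⟩

/-- A point annihilated by all characters trivial on a subgroup of the torus lies in the Zariski
closure of that subgroup. -/
lemma diagHom_mem_mcl (G : Subgroup (Fin d → Qbarˣ)) (x : Fin d → Qbarˣ)
    (hx : ∀ v, (∀ g ∈ G, torusChar v g = 1) → torusChar v x = 1) :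
    (diagHom d x : Matrix (Fin d) (Fin d) Qbar) ∈
      mcl ((fun h : GL (Fin d) Qbar => (h : Matrix (Fin d) (Fin d) Qbar)) ''
        (diagHom d '' (G : Set (Fin d → Qbarˣ)))) := by
  intro p hp
  let q : MvPolynomial (Fin d) Qbar :=
    bind₁ (fun ij : Fin d × Fin d => if ij.1 = ij.2 then X ij.1 else 0) p
  let e : (Fin d →₀ ℕ) → Fin d → ℤ := fun m i => m i
  have hmon : ∀ (y : Fin d → Qbarˣ) (m : Fin d →₀ ℕ),
      ∏ i, (y i : Qbar) ^ m i = (torusChar (e m) y : Qbar) := fun y m => by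
    simp [torusChar_apply, e]
  have hq : ∀ y : Fin d → Qbarˣ,
      eval (fun ij => (diagHom d y : Matrix (Fin d) (Fin d) Qbar) ij.1 ij.2) p =
        ∑ m ∈ q.support, q.coeff m * (torusChar (e m) y : Qbar) := fun y => by
    simp_rw [← hmon, ← eval_eq']
    rw [← aeval_eq_eval, ← aeval_eq_eval, aeval_bind₁]
    congr 2
    funext ij
    by_cases h : ij.1 = ij.2 <;> simp [coe_diagHom, h]
  rw [hq]
  refine sum_eq_zero_of_characters q.support
    (fun m => (Units.coeHom Qbar).comp ((torusChar (e m)).comp G.subtype)) _ _ (fun g => ?_) ?_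
  · exact (hq g).symm.trans (hp _ ⟨_, ⟨g, g.2, rfl⟩, rfl⟩)
  · intro m n hmn
    have := hx (e m - e n) fun g hg => by
      rw [torusChar_sub, div_eq_one]
      have : (torusChar (e m) g : Qbar) = torusChar (e n) g :=
        DFunLike.congr_fun hmn (⟨g, hg⟩ : G)
      exact Units.ext this
    rw [torusChar_sub, div_eq_one] at this
    rw [this]

lemma coe_mem_topcl {S : Set (GL (Fin d) Qbar)} {A : GL (Fin d) Qbar}
    (hA : A ∈ Subgroup.closure S) : A ∈ topcl S :=
  fun _ hp => hp _ ⟨A, hA, rfl⟩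

/-- A torus character trivial on generators is trivial on every diagonal matrix they
topologically generate. -/
lemma torusChar_eq_one_of_mem_topcl {S : Set (Fin d → Qbarˣ)} {v : Fin d → ℤ}
    (hv : ∀ g ∈ S, torusChar v g = 1) {x : Fin d → Qbarˣ}
    (hx : diagHom d x ∈ topcl (diagHom d '' S)) : torusChar v x = 1 := by
  let p : MvPolynomial (Fin d × Fin d) Qbar :=
    ∏ i, X (i, i) ^ (v i).toNat - ∏ i, X (i, i) ^ (-v i).toNat
  have hp : ∀ y : Fin d → Qbarˣ,
      eval (fun ij => (diagHom d y : Matrix (Fin d) (Fin d) Qbar) ij.1 ij.2) p = 0 ↔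
        torusChar v y = 1 := fun y => by
    have hsplit : v = (fun i => ((v i).toNat : ℤ)) - fun i => ((-v i).toNat : ℤ) := by
      funext i
      simp only [Pi.sub_apply]
      omega
    conv_rhs => rw [hsplit, torusChar_sub, div_eq_one, Units.ext_iff]
    simp [p, sub_eq_zero, coe_diagHom, torusChar_apply, -Int.ofNat_toNat]
  refine (hp x).mp (hx p ?_)
  rintro _ ⟨h, hh, rfl⟩
  rw [← MonoidHom.map_closure] at hh
  obtain ⟨y, hy, rfl⟩ := hh
  exact (hp y).mpr ((Subgroup.closure_le (torusChar v).ker).mpr hv hy)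

/-- Matrices topologically generated by diagonal matrices are diagonal. -/
lemma exists_eq_diagHom_of_mem_topcl {S : Set (Fin d → Qbarˣ)} {A : GL (Fin d) Qbar}
    (hA : A ∈ topcl (diagHom d '' S)) : ∃ x, diagHom d x = A := by
  have hoff : ∀ i j, i ≠ j → (A : Matrix (Fin d) (Fin d) Qbar) i j = 0 := fun i j hij => by
    have := hA (X (i, j)) ?_
    · simpa using this
    rintro _ ⟨h, hh, rfl⟩
    rw [← MonoidHom.map_closure] at hh
    obtain ⟨y, -, rfl⟩ := hh
    simp [coe_diagHom, hij]
  have hdiag : (A : Matrix (Fin d) (Fin d) Qbar) =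
      Matrix.diagonal fun i => (A : Matrix (Fin d) (Fin d) Qbar) i i := by
    ext i j
    by_cases hij : i = j
    · simp [hij]
    · rw [hoff i j hij, Matrix.diagonal_apply_ne _ hij]
  have hdet : ∀ i, (A : Matrix (Fin d) (Fin d) Qbar) i i ≠ 0 := fun i => by
    have := ((Matrix.isUnit_iff_isUnit_det _).mp A.isUnit).ne_zero
    rw [hdiag, Matrix.det_diagonal] at this
    exact Finset.prod_ne_zero_iff.mp this i (Finset.mem_univ i)
  exact ⟨fun i => Units.mk0 _ (hdet i), Units.ext hdiag.symm⟩

/-- `Δ(H_Λ)` has a topologically generating family of size `ι` iff `ℤ^d/Λ` has a separating family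
of characters of size `ι`. -/
lemma exists_topcl_eq_iff {ι : Type*} (Λ : Submodule ℤ (Fin d → ℤ)) :
    (∃ M : ι → GL (Fin d) Qbar, diagHom d '' HLat Λ = topcl (Set.range M)) ↔
      ∃ φ : ι → Multiplicative ((Fin d → ℤ) ⧸ Λ) →* Qbarˣ, ∀ a, (∀ i, φ i a = 1) → a = 1 := by
  constructor
  · rintro ⟨M, hM⟩
    have hg : ∀ i, ∃ g ∈ HLat Λ, diagHom d g = M i := fun i =>
      by
      have : M i ∈ diagHom d '' HLat Λ :=
        hM ▸ coe_mem_topcl (Subgroup.subset_closure ⟨i, rfl⟩)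
      exact this
    choose g hgΛ hgM using hg
    choose φ hφ using fun i => exists_character_of_mem_HLat (hgΛ i)
    refine ⟨φ, fun a ha => eq_one_of_forall_character _ a fun ψ => ?_⟩
    obtain ⟨v, hv⟩ := Λ.mkQ_surjective a.toAdd
    obtain rfl : Multiplicative.ofAdd (Λ.mkQ v) = a := congrArg Multiplicative.ofAdd hv
    rw [← torusChar_eq_character]
    refine torusChar_eq_one_of_mem_topcl (S := Set.range g) ?_ ?_
    · rintro _ ⟨i, rfl⟩
      rw [← hφ, ha]
    · rw [← Set.range_comp, show diagHom d ∘ g = M from funext hgM, ← hM]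
      refine ⟨_, fun w hw => ?_, rfl⟩
      have := torusChar_eq_character ψ w
      rw [Submodule.mkQ_apply, (Submodule.Quotient.mk_eq_zero Λ).mpr hw, ofAdd_zero, map_one] at this
      exact this
  · rintro ⟨φ, hφ⟩
    let g : ι → Fin d → Qbarˣ := fun i j =>
      φ i (Multiplicative.ofAdd (Λ.mkQ (Pi.single j 1)))
    have hg : ∀ v, v ∈ Λ ↔ ∀ i, torusChar v (g i) = 1 := fun v => by
      simp_rw [g, torusChar_eq_character]
      rw [← Submodule.Quotient.mk_eq_zero]
      exact ⟨fun h i => (congrArg (φ i) (congrArg Multiplicative.ofAdd h)).trans (map_one (φ i)),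
        fun h => hφ _ h⟩
    refine ⟨diagHom d ∘ g, ?_⟩
    rw [Set.range_comp]
    apply Set.Subset.antisymm
    · rintro _ ⟨x, hx, rfl⟩
      have := diagHom_mem_mcl (Subgroup.closure (Set.range g)) x fun v hv =>
        hx v ((hg v).mpr fun i => hv _ (Subgroup.subset_closure ⟨i, rfl⟩))
      rw [← Subgroup.coe_map, MonoidHom.map_closure] at this
      exact this
    · intro A hA
      obtain ⟨x, rfl⟩ := exists_eq_diagHom_of_mem_topcl hA
      refine ⟨x, fun v hv => torusChar_eq_one_of_mem_topcl ?_ hA, rfl⟩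
      rintro _ ⟨i, rfl⟩
      exact (hg v).mp hv i

end Diagonal

/-- The group of diagonal matrices `{Δ(g) : g ∈ H_Λ}` is `s`-generated iff the torsion
subgroup of `ℤ^d/Λ` is generated by `s` elements. -/
theorem stmt1 (d r s : ℕ) (hs1 : 1 ≤ s) (hsr : s ≤ r)
    (Λ : Submodule ℤ (Fin d → ℤ)) (hrank : Module.finrank ℤ Λ = r) :
    (∃ M : Fin s → GL (Fin d) Qbar,
      {A : GL (Fin d) Qbar | ∃ g ∈ HLat Λ,
          (A : Matrix (Fin d) (Fin d) Qbar) = Matrix.diagonal (fun i => (g i : Qbar))}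
        = topcl (Set.range M)) ↔
    (∃ t : Fin s → Submodule.torsion ℤ ((Fin d → ℤ) ⧸ Λ),
      Submodule.span ℤ (Set.range t) = ⊤) := by
  have : Nonempty (Fin s) := ⟨⟨0, hs1⟩⟩
  simp_rw [setOf_diagonal_eq_image]
  rw [exists_topcl_eq_iff, exists_span_torsion_eq_top_iff]
end
end

section
/- Let g_1,…,g_d ∈ ℚ̄^× be multiplicatively independent, i.e., whenever g_1^{n_1}⋯g_d^{n_d} = 1 for integers n_1,…,n_d one has n_1 = ⋯ = n_d = 0. Then the Zariski closure in ℚ̄^d of the set {(g_1^n, …, g_d^n) : n ∈ ℤ} is all of ℚ̄^d. -/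
open Matrix MvPolynomial

noncomputable section

/-- If distinct monomials take distinct values at `x`, then a polynomial vanishing at all the
powers of `x` is zero. -/
theorem eq_zero_of_eval_pow_eq_zero {ι R : Type*} [CommRing R] [IsDomain R] {x : ι → R}
    (hx : Function.Injective fun m : ι →₀ ℕ => m.prod fun i k => x i ^ k)
    {p : MvPolynomial ι R} (hp : ∀ n : ℕ, eval (x ^ n) p = 0) : p = 0 := by
  have hli := (linearIndependent_monoidHom (Multiplicative ℕ) R).comp
    (fun m : ι →₀ ℕ => powersHom R (m.prod fun i k => x i ^ k))
    ((powersHom R).injective.comp hx)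
  have hsum : ∑ m ∈ p.support, p.coeff m •
      ⇑(powersHom R (m.prod fun i k => x i ^ k)) = 0 := by
    funext n
    rw [Pi.zero_apply, ← hp n.toAdd, eval_eq, Finset.sum_apply]
    refine Finset.sum_congr rfl fun m _ => ?_
    simp only [Pi.smul_apply, smul_eq_mul, powersHom_apply, Finsupp.prod,
      Pi.pow_apply, ← Finset.prod_pow, pow_right_comm]
  ext m
  by_cases hm : m ∈ p.support
  · exact linearIndependent_iff'.1 hli _ _ hsum m hm
  · exact notMem_support_iff.1 hm

/-- Distinct monomials take distinct values at a multiplicatively independent tuple of units. -/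
theorem injective_prod_pow_of_multiplicatively_independent {ι R : Type*} [Fintype ι]
    [CommRing R] {g : ι → Rˣ} (hind : ∀ n : ι → ℤ, (∏ i, g i ^ n i) = 1 → ∀ i, n i = 0) :
    Function.Injective fun m : ι →₀ ℕ => m.prod fun i k => (g i : R) ^ k := by
  intro a b hab
  have hval : ∏ i, g i ^ a i = ∏ i, g i ^ b i := by
    ext
    simpa [Finsupp.prod_fintype] using hab
  ext i
  have := hind (fun i => a i - b i)
    (by simp [_root_.zpow_sub, Finset.prod_mul_distrib, hval]) i
  lia

/-- If `g₁, …, g_d ∈ Qbarˣ` are multiplicatively independent then the Zariski closure of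
`{(g₁ⁿ, …, g_dⁿ) : n ∈ ℤ}` is all of `Qbar^d`. -/
theorem stmt4 (d : ℕ) (g : Fin d → Qbarˣ)
    (hind : ∀ n : Fin d → ℤ, (∏ i, g i ^ n i) = 1 → ∀ i, n i = 0) :
    zcl {x : Fin d → Qbar | ∃ n : ℤ, x = fun i => ((g i ^ n : Qbarˣ) : Qbar)} =
      Set.univ := by
  refine Set.eq_univ_of_forall fun y p hp => ?_
  rw [eq_zero_of_eval_pow_eq_zero (injective_prod_pow_of_multiplicatively_independent hind)
    (p := p) fun n => hp _ ⟨n, by ext i; simp⟩, map_zero]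
end
end

section
/- Let G ⊆ GL_d(ℚ̄) be a Zariski-closed commutative subgroup all of whose elements are unipotent, and let L := {log A : A ∈ G} ⊆ ℚ̄^{d×d}. Assume that L is a ℚ̄-linear subspace of ℚ̄^{d×d} consisting of nilpotent matrices and that exp and log restrict to mutually inverse bijections between L and G. Then for every s ≥ 1: there exist A_1,…,A_s ∈ G with G = cl⟨A_1,…,A_s⟩ if and only if L is spanned as a ℚ̄-vector space by a set of s matrices. -/
open Matrix MvPolynomial

noncomputable section

/-- A matrix `M` is unipotent if `(M - Id)^d = 0`. -/
def IsUnipotentM {d : ℕ} (M : Matrix (Fin d) (Fin d) Qbar) : Prop := (M - 1) ^ d = 0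

/-- Matrix logarithm of a unipotent matrix. -/
def mlog {d : ℕ} (A : Matrix (Fin d) (Fin d) Qbar) : Matrix (Fin d) (Fin d) Qbar :=
  ∑ k ∈ Finset.Icc 1 (d - 1), ((-1 : Qbar) ^ (k + 1) * (k : Qbar)⁻¹) • (A - 1) ^ k

/-- Matrix exponential of a nilpotent matrix. -/
def mexp {d : ℕ} (N : Matrix (Fin d) (Fin d) Qbar) : Matrix (Fin d) (Fin d) Qbar :=
  ∑ k ∈ Finset.range d, ((k.factorial : Qbar)⁻¹) • N ^ k

/-- The polynomial whose value at a matrix is its logarithm. -/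
def logPoly (d : ℕ) : Polynomial Qbar :=
  ∑ k ∈ Finset.Icc 1 (d - 1),
    ((-1 : Qbar) ^ (k + 1) * (k : Qbar)⁻¹) • (Polynomial.X - 1) ^ k

/-- The polynomial whose value at a matrix is its truncated exponential. -/
def expPoly (d : ℕ) : Polynomial Qbar :=
  ∑ k ∈ Finset.range d, ((k.factorial : Qbar)⁻¹) • Polynomial.X ^ k

lemma mlog_eq_aeval {d : ℕ} (A : Matrix (Fin d) (Fin d) Qbar) :
    mlog A = Polynomial.aeval A (logPoly d) := by
  simp [mlog, logPoly]

lemma mexp_eq_aeval {d : ℕ} (A : Matrix (Fin d) (Fin d) Qbar) :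
    mexp A = Polynomial.aeval A (expPoly d) := by
  simp [mexp, expPoly]

lemma mlog_one {d : ℕ} : mlog (1 : Matrix (Fin d) (Fin d) Qbar) = 0 := by
  refine Finset.sum_eq_zero fun k hk => ?_
  have : k ≠ 0 := by have := (Finset.mem_Icc.1 hk).1; omega
  simp [this]

lemma commute_mlog {d : ℕ} {A B : Matrix (Fin d) (Fin d) Qbar} (h : Commute A B) :
    Commute (mlog A) (mlog B) := by
  have h1 : Commute (A - 1) (B - 1) :=
    (h.sub_left (Commute.one_left B)).sub_right (Commute.one_right _)
  exact Commute.sum_left _ _ _ fun k _ => Commute.sum_right _ _ _ fun l _ =>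
    ((h1.pow_pow k l).smul_left _).smul_right _

lemma mexp_eq_exp {d : ℕ} {N : Matrix (Fin d) (Fin d) Qbar} (h : N ^ d = 0) :
    mexp N = IsNilpotent.exp N := by
  rw [IsNilpotent.exp_eq_sum h, mexp]
  refine Finset.sum_congr rfl fun k _ => ?_
  rw [← algebraMap_smul Qbar ((k.factorial : ℚ)⁻¹) (N ^ k)]
  simp

lemma mexp_zero {d : ℕ} : mexp (0 : Matrix (Fin d) (Fin d) Qbar) = 1 := by
  rcases d with _ | d
  · exact Subsingleton.elim _ _
  · rw [mexp_eq_exp (by simp), IsNilpotent.exp_zero]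

lemma mexp_add {d : ℕ} {M N : Matrix (Fin d) (Fin d) Qbar} (hMN : Commute M N)
    (hM : M ^ d = 0) (hN : N ^ d = 0) (hadd : (M + N) ^ d = 0) :
    mexp (M + N) = mexp M * mexp N := by
  rw [mexp_eq_exp hM, mexp_eq_exp hN, mexp_eq_exp hadd,
    IsNilpotent.exp_add_of_commute hMN ⟨d, hM⟩ ⟨d, hN⟩]

/-- Evaluating the coefficients commutes with applying a polynomial to a matrix. -/
lemma aeval_map_eval {d : ℕ} {σ : Type*} (P : Polynomial Qbar)
    (M : Matrix (Fin d) (Fin d) (MvPolynomial σ Qbar)) (x : σ → Qbar) :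
    (Polynomial.aeval M P).map (eval x) = Polynomial.aeval (M.map (eval x)) P := by
  have h := Polynomial.aeval_algHom_apply (MvPolynomial.aeval x).mapMatrix M P
  exact h.symm

/-- If `mlog` maps a set into a linear subspace, it maps its Zariski closure there too. -/
lemma mlog_mem_of_mem_mcl {d : ℕ} {E : Set (Matrix (Fin d) (Fin d) Qbar)}
    {V : Submodule Qbar (Matrix (Fin d) (Fin d) Qbar)} (hE : ∀ B ∈ E, mlog B ∈ V)
    {A : Matrix (Fin d) (Fin d) Qbar} (hA : A ∈ mcl E) : mlog A ∈ V := by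
  by_contra hAV
  obtain ⟨f, hfA, hfV⟩ := Submodule.exists_le_ker_of_notMem hAV
  have hf : ∀ M : Matrix (Fin d) (Fin d) Qbar,
      f M = ∑ i, ∑ j, M i j * f (Matrix.single i j 1) := by
    intro M
    conv_lhs => rw [Matrix.matrix_eq_sum_single M]
    simp only [map_sum]
    refine Finset.sum_congr rfl fun i _ => Finset.sum_congr rfl fun j _ => ?_
    rw [← smul_eq_mul, ← map_smul, Matrix.smul_single, smul_eq_mul, mul_one]
  let p : MvPolynomial (Fin d × Fin d) Qbar := ∑ i, ∑ j,
    (Polynomial.aeval (Matrix.mvPolynomialX (Fin d) (Fin d) Qbar) (logPoly d)) i j *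
      C (f (Matrix.single i j 1))
  have hp : ∀ M : Matrix (Fin d) (Fin d) Qbar,
      eval (fun ij => M ij.1 ij.2) p = f (mlog M) := by
    intro M
    have h := aeval_map_eval (logPoly d) (Matrix.mvPolynomialX (Fin d) (Fin d) Qbar)
      (fun ij => M ij.1 ij.2)
    have hX := Matrix.mvPolynomialX_mapMatrix_eval M
    rw [RingHom.mapMatrix_apply] at hX
    rw [hX, ← mlog_eq_aeval] at h
    rw [hf, ← h]
    simp [p]
  apply hfA
  rw [← hp]
  refine hA p fun B hB => ?_
  rw [hp]
  exact hfV (hE B hB)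

/-- A Zariski-closed condition on `mexp (∑ i, t i • B i)` which holds for natural `t` holds
for all `t`. -/
lemma mexp_sum_mem_mcl {d s : ℕ} {E : Set (Matrix (Fin d) (Fin d) Qbar)}
    {B : Fin s → Matrix (Fin d) (Fin d) Qbar}
    (hE : ∀ n : Fin s → ℕ, mexp (∑ i, n i • B i) ∈ E) (c : Fin s → Qbar) :
    mexp (∑ i, c i • B i) ∈ mcl E := by
  intro p hp
  let M : Matrix (Fin d) (Fin d) (MvPolynomial (Fin s) Qbar) :=
    ∑ i, (X i : MvPolynomial (Fin s) Qbar) • (B i).map C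
  have hM : ∀ t : Fin s → Qbar, M.map (eval t) = ∑ i, t i • B i := by
    intro t
    ext i j
    simp [M, Matrix.sum_apply]
  let q : MvPolynomial (Fin s) Qbar :=
    bind₁ (fun ij => Polynomial.aeval M (expPoly d) ij.1 ij.2) p
  have hq : ∀ t : Fin s → Qbar,
      eval t q = eval (fun ij => mexp (∑ i, t i • B i) ij.1 ij.2) p := by
    intro t
    rw [mexp_eq_aeval, ← hM, ← aeval_map_eval]
    exact MvPolynomial.eval₂Hom_bind₁ (RingHom.id Qbar) t _ p
  have hq0 : q = 0 := by
    refine MvPolynomial.funext_set (fun _ => Set.range (Nat.cast : ℕ → Qbar))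
      (fun _ => Set.infinite_range_of_injective Nat.cast_injective) fun x hx => ?_
    choose n hn using fun i => hx i (Set.mem_univ i)
    obtain rfl : (fun i => (n i : Qbar)) = x := _root_.funext hn
    rw [hq, map_zero]
    refine hp _ ?_
    simpa only [Nat.cast_smul_eq_nsmul] using hE n
  rw [← hq, hq0, map_zero]

/-- A Zariski-closed commutative unipotent group `G` is topologically `s`-generated iff
the linear space `L = log G` is spanned by `s` matrices. -/
theorem stmt6 (d : ℕ) (G : Subgroup (GL (Fin d) Qbar))
    (hclosed : ∀ g : GL (Fin d) Qbar,
      (g : Matrix (Fin d) (Fin d) Qbar) ∈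
        mcl ((fun h : GL (Fin d) Qbar => (h : Matrix (Fin d) (Fin d) Qbar)) ''
          (G : Set (GL (Fin d) Qbar))) → g ∈ G)
    (hcomm : ∀ a b : GL (Fin d) Qbar, a ∈ G → b ∈ G → a * b = b * a)
    (hunip : ∀ A : GL (Fin d) Qbar, A ∈ G →
      IsUnipotentM (A : Matrix (Fin d) (Fin d) Qbar))
    (L : Set (Matrix (Fin d) (Fin d) Qbar))
    (hL : L = {N | ∃ A : GL (Fin d) Qbar, A ∈ G ∧
      N = mlog (A : Matrix (Fin d) (Fin d) Qbar)})
    (hLlin : ∃ W : Submodule Qbar (Matrix (Fin d) (Fin d) Qbar),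
      (W : Set (Matrix (Fin d) (Fin d) Qbar)) = L)
    (hLnil : ∀ N ∈ L, N ^ d = 0)
    (hlogexp : ∀ A : GL (Fin d) Qbar, A ∈ G →
      mexp (mlog (A : Matrix (Fin d) (Fin d) Qbar)) = (A : Matrix (Fin d) (Fin d) Qbar))
    (hexplog : ∀ N ∈ L, (∃ A : GL (Fin d) Qbar, A ∈ G ∧
      (A : Matrix (Fin d) (Fin d) Qbar) = mexp N) ∧ mlog (mexp N) = N) :
    ∀ s : ℕ, 1 ≤ s →
      ((∃ A : Fin s → GL (Fin d) Qbar, (∀ i, A i ∈ G) ∧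
          (G : Set (GL (Fin d) Qbar)) = topcl (Set.range A)) ↔
        (∃ B : Fin s → Matrix (Fin d) (Fin d) Qbar,
          (Submodule.span Qbar (Set.range B) : Set (Matrix (Fin d) (Fin d) Qbar)) = L)) := by
  obtain ⟨W, rfl⟩ := hLlin
  have hlogmem : ∀ A : GL (Fin d) Qbar, A ∈ G →
      mlog (A : Matrix (Fin d) (Fin d) Qbar) ∈ W := by
    intro A hA
    rw [← SetLike.mem_coe, hL]
    exact ⟨A, hA, rfl⟩
  have hWcomm : ∀ M ∈ W, ∀ N ∈ W, Commute M N := by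
    intro M hM N hN
    rw [← SetLike.mem_coe, hL] at hM hN
    obtain ⟨A, hA, rfl⟩ := hM
    obtain ⟨B, hB, rfl⟩ := hN
    exact commute_mlog (congrArg Units.val (hcomm A B hA hB))
  have hWadd : ∀ M ∈ W, ∀ N ∈ W, mexp (M + N) = mexp M * mexp N := fun M hM N hN =>
    mexp_add (hWcomm M hM N hN) (hLnil M hM) (hLnil N hN) (hLnil _ (W.add_mem hM hN))
  have hlogmul : ∀ A ∈ G, ∀ B ∈ G,
      mlog ((A * B : GL (Fin d) Qbar) : Matrix (Fin d) (Fin d) Qbar) =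
        mlog (A : Matrix (Fin d) (Fin d) Qbar) + mlog (B : Matrix (Fin d) (Fin d) Qbar) := by
    intro A hA B hB
    rw [Units.val_mul, ← hlogexp A hA, ← hlogexp B hB,
      ← hWadd _ (hlogmem A hA) _ (hlogmem B hB),
      (hexplog _ (W.add_mem (hlogmem A hA) (hlogmem B hB))).2, hlogexp A hA, hlogexp B hB]
  intro s _
  constructor
  · rintro ⟨A, hAG, hA⟩
    let B : Fin s → Matrix (Fin d) (Fin d) Qbar := fun i => mlog (A i : Matrix _ _ Qbar)
    refine ⟨B, ?_⟩
    have hsub : ∀ g ∈ Subgroup.closure (Set.range A),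
        g ∈ G ∧ mlog (g : Matrix (Fin d) (Fin d) Qbar) ∈ Submodule.span Qbar (Set.range B) := by
      intro g hg
      induction hg using Subgroup.closure_induction with
      | mem x hx =>
        obtain ⟨i, rfl⟩ := hx
        exact ⟨hAG i, Submodule.subset_span ⟨i, rfl⟩⟩
      | one => exact ⟨G.one_mem, by simp [mlog_one]⟩
      | mul x y _ _ hx hy =>
        refine ⟨G.mul_mem hx.1 hy.1, ?_⟩
        rw [hlogmul x hx.1 y hy.1]
        exact Submodule.add_mem _ hx.2 hy.2
      | inv x _ hx =>
        refine ⟨G.inv_mem hx.1, ?_⟩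
        have h := hlogmul x hx.1 x⁻¹ (G.inv_mem hx.1)
        rw [mul_inv_cancel, Units.val_one, mlog_one] at h
        rw [← neg_eq_of_add_eq_zero_right h.symm]
        exact Submodule.neg_mem _ hx.2
    refine Set.Subset.antisymm ?_ ?_
    · refine SetLike.coe_subset_coe.2 (Submodule.span_le.2 ?_)
      rintro _ ⟨i, rfl⟩
      exact hlogmem _ (hAG i)
    · rw [hL]
      rintro _ ⟨g, hg, rfl⟩
      have hg' : g ∈ topcl (Set.range A) := hA ▸ hg
      refine mlog_mem_of_mem_mcl ?_ hg'
      rintro _ ⟨h, hh, rfl⟩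
      exact (hsub h hh).2
  · rintro ⟨B, hB⟩
    have hBW : ∀ i, B i ∈ W := fun i => by
      rw [← SetLike.mem_coe, ← hB]
      exact Submodule.subset_span ⟨i, rfl⟩
    choose A hAG hA using fun i => (hexplog (B i) (hBW i)).1
    refine ⟨A, hAG, Set.Subset.antisymm ?_ ?_⟩
    · intro g hg
      have hgB : mlog (g : Matrix (Fin d) (Fin d) Qbar) ∈ Submodule.span Qbar (Set.range B) := by
        rw [← SetLike.mem_coe, hB]
        exact hlogmem g hg
      obtain ⟨c, hc⟩ := (Submodule.mem_span_range_iff_exists_fun Qbar).1 hgB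
      change (g : Matrix (Fin d) (Fin d) Qbar) ∈ mcl _
      rw [← hlogexp g hg, ← hc]
      refine mexp_sum_mem_mcl (fun n => ?_) c
      let T : AddSubmonoid (Matrix (Fin d) (Fin d) Qbar) :=
        { carrier := {N | N ∈ W ∧ ∃ h ∈ Subgroup.closure (Set.range A),
            (h : Matrix (Fin d) (Fin d) Qbar) = mexp N}
          zero_mem' := ⟨W.zero_mem, 1, Subgroup.one_mem _, by simp [mexp_zero]⟩
          add_mem' := by
            rintro M N ⟨hM, a, ha, haM⟩ ⟨hN, b, hb, hbN⟩
            exact ⟨W.add_mem hM hN, a * b, Subgroup.mul_mem _ ha hb, by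
              rw [Units.val_mul, haM, hbN, hWadd M hM N hN]⟩ }
      have hT : ∑ i, n i • B i ∈ T := sum_mem fun i _ =>
        nsmul_mem (show B i ∈ T from
          ⟨hBW i, A i, Subgroup.subset_closure ⟨i, rfl⟩, hA i⟩) _
      obtain ⟨-, h, hh, heq⟩ := hT
      exact ⟨h, hh, heq⟩
    · intro g hg
      refine hclosed g fun p hp => hg p ?_
      rintro _ ⟨h, hh, rfl⟩
      refine hp _ ⟨h, ?_, rfl⟩
      refine (Subgroup.closure_le G).2 ?_ hh
      rintro _ ⟨i, rfl⟩
      exact hAG i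
end
end

section
/- For any vectors v_1,…,v_s ∈ ℚ̄^n, the Zariski closure of the set {n_1v_1 + ⋯ + n_sv_s : n_1,…,n_s ∈ ℤ} equals the ℚ̄-linear span of v_1,…,v_s. -/
open Matrix MvPolynomial

noncomputable section

/-- A polynomial over `Qbar` vanishing at all integer points is zero. -/
lemma eq_zero_of_eval_intCast {s : ℕ} (q : MvPolynomial (Fin s) Qbar)
    (h : ∀ c : Fin s → ℤ, eval (fun i => (c i : Qbar)) q = 0) : q = 0 := by
  refine funext_set (fun _ => Set.range ((↑) : ℤ → Qbar))
    (fun _ => Set.infinite_range_of_injective Int.cast_injective) fun x hx => ?_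
  choose c hc using fun i => hx i (Set.mem_univ i)
  obtain rfl : (fun i => (c i : Qbar)) = x := _root_.funext hc
  simpa using h c

/-- Pulling a polynomial back along the parametrization `a ↦ ∑ i, a i • v i`. -/
lemma eval_bind₁_linearCombination {n s : ℕ} (v : Fin s → (Fin n → Qbar))
    (p : MvPolynomial (Fin n) Qbar) (a : Fin s → Qbar) :
    eval a (bind₁ (fun j => ∑ i, C (v i j) * X i) p) = eval (∑ i, a i • v i) p := by
  rw [← aeval_eq_eval, ← aeval_eq_eval, aeval_bind₁]
  congr 2
  ext j
  simp [Finset.sum_apply, mul_comm]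

/-- Linear subspaces are Zariski closed. -/
lemma zcl_subset_submodule {ι : Type} [Fintype ι] {E : Set (ι → Qbar)}
    (W : Submodule Qbar (ι → Qbar)) (hE : E ⊆ W) : zcl E ⊆ W := by
  classical
  intro x hx
  by_contra hxW
  obtain ⟨f, hfx, hf⟩ := W.exists_le_ker_of_notMem hxW
  have hp (y : ι → Qbar) : eval y (∑ j, C (f (Pi.single j 1)) * X j) = f y := by
    rw [LinearMap.pi_apply_eq_sum_univ f y]
    simp only [map_sum, map_mul, eval_C, eval_X, smul_eq_mul]
    refine Finset.sum_congr rfl fun j _ => ?_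
    rw [mul_comm]
    congr 2
    ext k
    simp [Pi.single_apply, eq_comm]
  exact hfx ((hp x).symm.trans (hx _ fun y hy => (hp y).trans (hf (hE hy))))

/-- The Zariski closure of the set of integer combinations of `v₁, …, v_s` equals their
`Qbar`-linear span. -/
theorem stmt7 (n s : ℕ) (v : Fin s → (Fin n → Qbar)) :
    zcl {x : Fin n → Qbar | ∃ c : Fin s → ℤ, x = ∑ i, c i • v i} =
      (Submodule.span Qbar (Set.range v) : Set (Fin n → Qbar)) := by
  refine Set.Subset.antisymm (zcl_subset_submodule _ ?_) fun x hx p hp => ?_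
  · rintro _ ⟨c, rfl⟩
    exact sum_mem fun i _ => zsmul_mem (Submodule.subset_span (Set.mem_range_self i)) (c i)
  · obtain ⟨a, rfl⟩ := (Submodule.mem_span_range_iff_exists_fun Qbar).1 hx
    rw [← eval_bind₁_linearCombination]
    refine (congrArg (eval a) (eq_zero_of_eval_intCast _ fun c => ?_)).trans (map_zero _)
    rw [eval_bind₁_linearCombination]
    exact hp _ ⟨c, by simp only [Int.cast_smul_eq_zsmul]⟩
end
end

section
/- Let U_1,…,U_s ∈ GL_d(ℚ̄) be unipotent matrices and S_1,…,S_s ∈ GL_d(ℚ̄) be semisimple matrices, and suppose the matrices U_1,…,U_s,S_1,…,S_s pairwise commute. Then cl⟨U_1,…,U_s,S_1,…,S_s⟩ = cl⟨S_1U_1,…,S_sU_s⟩. -/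
open Matrix MvPolynomial

noncomputable section

/-- A matrix `M` is semisimple if it is diagonalisable over `Qbar`. -/
def IsSemisimpleM {d : ℕ} (M : Matrix (Fin d) (Fin d) Qbar) : Prop :=
  ∃ P : GL (Fin d) Qbar, ∃ D : Fin d → Qbar,
    M = ((P⁻¹ : GL (Fin d) Qbar) : Matrix (Fin d) (Fin d) Qbar) * Matrix.diagonal D *
      (P : Matrix (Fin d) (Fin d) Qbar)

section ExponentialPolynomials

variable {K : Type*} [Field K]

/-- The shift operator on sequences. -/
def seqShift (K : Type*) [Field K] : Module.End K (ℕ → K) where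
  toFun f n := f (n + 1)
  map_add' _ _ := rfl
  map_smul' _ _ := rfl

lemma seqShift_sub_smul_pow_apply_eq_zero (a : K) (k : ℕ) (q : Polynomial K)
    (hq : q.degree < k) :
    ((seqShift K - a • (1 : Module.End K (ℕ → K))) ^ k)
      (fun n => q.eval (n : K) * a ^ n) = 0 := by
  induction k generalizing q with
  | zero =>
    have : q = 0 := by simpa [Nat.WithBot.lt_zero_iff] using hq
    subst this
    ext n
    simp
  | succ k ih =>
    rw [pow_succ, Module.End.mul_apply]
    have hstep : (seqShift K - a • (1 : Module.End K (ℕ → K))) (fun n => q.eval (n : K) * a ^ n)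
        = fun n : ℕ => (Polynomial.C a * (Polynomial.taylor 1 q - q)).eval (n : K) * a ^ n := by
      ext n
      simp [seqShift, Polynomial.taylor_eval]
      ring
    rw [hstep]
    apply ih
    by_cases h0 : q = 0
    · simp [h0]
    have hlt : (Polynomial.taylor 1 q - q).degree < q.degree := by
      have := Polynomial.degree_sub_lt_left (p := Polynomial.taylor 1 q) (q := q)
        (Polynomial.degree_taylor q 1)
        (by simpa using h0) (Polynomial.leadingCoeff_taylor 1 q)
      rwa [Polynomial.degree_taylor] at this
    rw [← Polynomial.smul_eq_C_mul]
    refine lt_of_le_of_lt (Polynomial.degree_smul_le _ _) (hlt.trans_le ?_)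
    exact Polynomial.degree_le_of_natDegree_le
      (Nat.lt_succ_iff.mp ((Polynomial.natDegree_lt_iff_degree_lt h0).mpr hq))

lemma expPoly_mem_maxGenEigenspace (a : K) (q : Polynomial K) :
    (fun n : ℕ => q.eval (n : K) * a ^ n) ∈ (seqShift K).maxGenEigenspace a := by
  rw [Module.End.mem_maxGenEigenspace]
  refine ⟨q.natDegree + 1, seqShift_sub_smul_pow_apply_eq_zero a _ q ?_⟩
  exact lt_of_le_of_lt Polynomial.degree_le_natDegree (by exact_mod_cast Nat.lt_succ_self _)

/-- Evaluation of a formal exponential polynomial `∑ q_a [a]` at a pair of exponents: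
`∑ q_a(n) a ^ m`. -/
def expPolyEval (K : Type*) [Field K] (m n : ℕ) :
    MonoidAlgebra (Polynomial K) Kˣ →+* K :=
  MonoidAlgebra.liftNCRingHom (Polynomial.evalRingHom (n : K))
    ((Units.coeHom K).comp (powMonoidHom m)) fun _ _ => Commute.all _ _

lemma expPolyEval_single (m n : ℕ) (a : Kˣ) (q : Polynomial K) :
    expPolyEval K m n (MonoidAlgebra.single a q) = q.eval (n : K) * (a : K) ^ m := by
  simp [expPolyEval]

/-- A formal exponential polynomial which vanishes along the diagonal vanishes. -/
lemma eq_zero_of_expPolyEval_diag [CharZero K] (G : MonoidAlgebra (Polynomial K) Kˣ)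
    (hG : ∀ n, expPolyEval K n n G = 0) : G = 0 := by
  have hsum : ∀ m n, expPolyEval K m n G =
      ∑ a ∈ G.coeff.support, (G.coeff a).eval (n : K) * (a : K) ^ m := by
    intro m n
    conv_lhs => rw [← MonoidAlgebra.sum_coeff_single G]
    rw [Finsupp.sum, map_sum]
    exact Finset.sum_congr rfl fun a _ => expPolyEval_single m n a _
  have hind : iSupIndep fun a : Kˣ => (seqShift K).maxGenEigenspace (a : K) :=
    (seqShift K).independent_maxGenEigenspace.comp Units.val_injective
  have hzero := (iSupIndep_iff_finsetSum_eq_zero_imp_eq_zero _).mp hind G.coeff.support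
    (fun a n => (G.coeff a).eval (n : K) * (a : K) ^ n)
    (fun a _ => expPoly_mem_maxGenEigenspace (a : K) (G.coeff a))
    (by
      ext n
      rw [Finset.sum_apply, ← hsum, hG, Pi.zero_apply])
  have hcoeff : G.coeff = 0 := by
    rw [← Finsupp.support_eq_empty, Finset.eq_empty_iff_forall_notMem]
    intro a ha
    refine Finsupp.mem_support_iff.mp ha ?_
    refine Polynomial.eq_zero_of_infinite_isRoot _
      ((Set.infinite_range_of_injective (Nat.cast_injective (R := K))).mono ?_)
    rintro _ ⟨n, rfl⟩
    have := congrFun (hzero a ha) n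
    simpa using this
  exact MonoidAlgebra.coeff_injective (by simpa using hcoeff)

variable {d : ℕ}

/-- The powers of a unipotent matrix are interpolated by a matrix of polynomials. -/
lemma exists_polynomial_matrix_pow [CharZero K] (M : Matrix (Fin d) (Fin d) K)
    (hM : (M - 1) ^ d = 0) :
    ∃ V : Matrix (Fin d) (Fin d) (Polynomial K),
      ∀ n : ℕ, V.map (Polynomial.eval (n : K)) = M ^ n := by
  refine ⟨∑ k ∈ Finset.range d, (Polynomial.C ((k.factorial : K)⁻¹) * descPochhammer K k) •
    ((M - 1) ^ k).map Polynomial.C, fun n => ?_⟩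
  have hpow : M ^ n = ∑ k ∈ Finset.range d, (n.choose k : K) • (M - 1) ^ k := by
    have h1 : M ^ n = ∑ k ∈ Finset.range (n + 1), (n.choose k : K) • (M - 1) ^ k := by
      conv_lhs => rw [← sub_add_cancel M 1, (Commute.one_right (M - 1)).add_pow]
      refine Finset.sum_congr rfl fun k _ => ?_
      rw [one_pow, mul_one, ← nsmul_eq_mul', Nat.cast_smul_eq_nsmul]
    rw [h1]
    trans ∑ k ∈ Finset.range (max (n + 1) d), (n.choose k : K) • (M - 1) ^ k
    · refine Finset.sum_subset (Finset.range_mono (le_max_left _ _)) fun k _ hk => ?_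
      rw [Nat.choose_eq_zero_of_lt (by simpa using hk), Nat.cast_zero, zero_smul]
    · refine (Finset.sum_subset (Finset.range_mono (le_max_right _ _)) fun k _ hk => ?_).symm
      rw [pow_eq_zero_of_le (by simpa using hk) hM, smul_zero]
  rw [hpow]
  ext i j
  simp only [Matrix.map_apply, Matrix.sum_apply, Matrix.smul_apply, Polynomial.eval_finsetSum,
    smul_eq_mul, Polynomial.eval_mul, Polynomial.eval_C]
  refine Finset.sum_congr rfl fun k _ => ?_
  rw [descPochhammer_eval_eq_descFactorial, Nat.descFactorial_eq_factorial_mul_choose,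
    Nat.cast_mul, inv_mul_cancel_left₀ (Nat.cast_ne_zero.mpr k.factorial_ne_zero)]

/-- The powers of an invertible diagonalizable matrix are interpolated by a matrix of formal
exponentials. -/
lemma exists_exponential_matrix_pow (P : GL (Fin d) K) (D : Fin d → Kˣ) :
    ∃ V : Matrix (Fin d) (Fin d) (MonoidAlgebra (Polynomial K) Kˣ),
      ∀ m n : ℕ, (expPolyEval K m n).mapMatrix V =
        ((P⁻¹ : GL (Fin d) K) : Matrix (Fin d) (Fin d) K) *
          Matrix.diagonal (fun i => (D i : K) ^ m) * (P : Matrix (Fin d) (Fin d) K) := by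
  let c : K →+* MonoidAlgebra (Polynomial K) Kˣ :=
    MonoidAlgebra.singleOneRingHom.comp Polynomial.C
  have hc : ∀ m n x, expPolyEval K m n (c x) = x := by
    intro m n x
    change expPolyEval K m n (MonoidAlgebra.single 1 (Polynomial.C x)) = x
    simp [expPolyEval_single]
  have hcM : ∀ m n (A : Matrix (Fin d) (Fin d) K),
      (expPolyEval K m n).mapMatrix (c.mapMatrix A) = A := by
    intro m n A
    ext i j
    exact hc m n _
  refine ⟨c.mapMatrix ((P⁻¹ : GL (Fin d) K) : Matrix (Fin d) (Fin d) K) *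
    Matrix.diagonal (fun i => MonoidAlgebra.single (D i) 1) *
    c.mapMatrix (P : Matrix (Fin d) (Fin d) K), fun m n => ?_⟩
  rw [map_mul, map_mul, hcM, hcM]
  congr 2
  rw [RingHom.mapMatrix_apply, Matrix.diagonal_map (map_zero _)]
  congr 1
  ext i
  simp [expPolyEval_single]

/-- A polynomial vanishing on `S ^ n * U ^ n` for all `n`, with `S` invertible diagonalizable and
`U` unipotent, vanishes on all `S ^ m * U ^ n`. -/
lemma eval_pow_mul_pow_eq_zero [CharZero K] (P : GL (Fin d) K) (D : Fin d → Kˣ)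
    (S U : Matrix (Fin d) (Fin d) K)
    (hS : S = ((P⁻¹ : GL (Fin d) K) : Matrix (Fin d) (Fin d) K) *
      Matrix.diagonal (fun i => (D i : K)) * (P : Matrix (Fin d) (Fin d) K))
    (hU : (U - 1) ^ d = 0) (p : MvPolynomial (Fin d × Fin d) K)
    (hp : ∀ n : ℕ, eval (fun ij => (S ^ n * U ^ n) ij.1 ij.2) p = 0) (m n : ℕ) :
    eval (fun ij => (S ^ m * U ^ n) ij.1 ij.2) p = 0 := by
  obtain ⟨V, hV⟩ := exists_exponential_matrix_pow P D
  obtain ⟨W, hW⟩ := exists_polynomial_matrix_pow U hU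
  have hSpow : ∀ m : ℕ, S ^ m = ((P⁻¹ : GL (Fin d) K) : Matrix (Fin d) (Fin d) K) *
      Matrix.diagonal (fun i => (D i : K) ^ m) * (P : Matrix (Fin d) (Fin d) K) := by
    intro m
    rw [hS, Units.conj_pow', Matrix.diagonal_pow]
    rfl
  let ι : Polynomial K →+* MonoidAlgebra (Polynomial K) Kˣ := MonoidAlgebra.singleOneRingHom
  have hι : ∀ m n q, expPolyEval K m n (ι q) = q.eval (n : K) := by
    intro m n q
    change expPolyEval K m n (MonoidAlgebra.single 1 q) = _
    simp [expPolyEval_single]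
  let Z := V * ι.mapMatrix W
  have hZ : ∀ m n, (expPolyEval K m n).mapMatrix Z = S ^ m * U ^ n := by
    intro m n
    rw [map_mul, hV, hSpow, ← hW]
    congr 1
    ext i j
    exact hι m n _
  let G := eval₂ (ι.comp Polynomial.C) (fun ij => Z ij.1 ij.2) p
  have hGe : ∀ m n, expPolyEval K m n G = eval (fun ij => (S ^ m * U ^ n) ij.1 ij.2) p := by
    intro m n
    have h1 : (expPolyEval K m n).comp (ι.comp Polynomial.C) = RingHom.id K := by
      ext x
      simp [hι]
    rw [show expPolyEval K m n G = _ from MvPolynomial.hom_eval₂ p _ _ _, h1, ← hZ]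
    rfl
  have hG : G = 0 := eq_zero_of_expPolyEval_diag G fun n => by rw [hGe, hp]
  rw [← hGe, hG, map_zero]

end ExponentialPolynomials

section TopologicalGeneration

variable {d : ℕ}

lemma topcl_mono_closure {A B : Set (GL (Fin d) Qbar)}
    (h : A ⊆ (Subgroup.closure B : Subgroup (GL (Fin d) Qbar))) : topcl A ⊆ topcl B := by
  intro g hg p hp
  refine hg p ?_
  rintro _ ⟨x, hx, rfl⟩
  exact hp _ ⟨x, (Subgroup.closure_le _).mpr h hx, rfl⟩

lemma mem_topcl_of_mem_closure {A : Set (GL (Fin d) Qbar)} {g : GL (Fin d) Qbar}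
    (h : g ∈ Subgroup.closure A) : g ∈ topcl A :=
  fun _ hp => hp _ ⟨g, h, rfl⟩

lemma exists_eval_mul_left {K : Type*} [Field K] (h : Matrix (Fin d) (Fin d) K)
    (p : MvPolynomial (Fin d × Fin d) K) :
    ∃ q : MvPolynomial (Fin d × Fin d) K, ∀ A : Matrix (Fin d) (Fin d) K,
      eval (fun ij => A ij.1 ij.2) q = eval (fun ij => (h * A) ij.1 ij.2) p := by
  refine ⟨bind₁ (fun ij => ∑ k, C (h ij.1 k) * X (k, ij.2)) p, fun A => ?_⟩
  rw [eval, eval₂Hom_bind₁]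
  change eval _ p = eval _ p
  congr 2
  ext ij
  change eval _ _ = _
  simp only [map_sum, map_mul, eval_C, eval_X, Matrix.mul_apply]

lemma exists_eval_mul_right {K : Type*} [Field K] (h : Matrix (Fin d) (Fin d) K)
    (p : MvPolynomial (Fin d × Fin d) K) :
    ∃ q : MvPolynomial (Fin d × Fin d) K, ∀ A : Matrix (Fin d) (Fin d) K,
      eval (fun ij => A ij.1 ij.2) q = eval (fun ij => (A * h) ij.1 ij.2) p := by
  refine ⟨bind₁ (fun ij => ∑ k, X (ij.1, k) * C (h k ij.2)) p, fun A => ?_⟩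
  rw [eval, eval₂Hom_bind₁]
  change eval _ p = eval _ p
  congr 2
  ext ij
  change eval _ _ = _
  simp only [map_sum, map_mul, eval_C, eval_X, Matrix.mul_apply]

lemma mul_mem_topcl {A : Set (GL (Fin d) Qbar)} {x y : GL (Fin d) Qbar}
    (hx : x ∈ topcl A) (hy : y ∈ topcl A) : x * y ∈ topcl A := by
  have hleft : ∀ h ∈ Subgroup.closure A, h * y ∈ topcl A := by
    intro h hh p hp
    obtain ⟨q, hq⟩ := exists_eval_mul_left (h : Matrix (Fin d) (Fin d) Qbar) p
    rw [Units.val_mul, ← hq]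
    refine hy q ?_
    rintro _ ⟨z, hz, rfl⟩
    rw [hq]
    exact hp _ ⟨h * z, mul_mem hh hz, rfl⟩
  intro p hp
  obtain ⟨q, hq⟩ := exists_eval_mul_right (y : Matrix (Fin d) (Fin d) Qbar) p
  rw [Units.val_mul, ← hq]
  refine hx q ?_
  rintro _ ⟨z, hz, rfl⟩
  rw [hq]
  exact hleft z hz p hp

lemma topcl_subset_topcl {A B : Set (GL (Fin d) Qbar)} (h : A ⊆ topcl B) (h' : A⁻¹ ⊆ topcl B) :
    topcl A ⊆ topcl B := by
  have hcl : ∀ g ∈ Subgroup.closure A, g ∈ topcl B := by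
    intro g hg
    rw [← Subgroup.mem_toSubmonoid, Subgroup.closure_toSubmonoid] at hg
    induction hg using Submonoid.closure_induction with
    | mem x hx => exact hx.elim (fun hx => h hx) fun hx => h' hx
    | one => exact mem_topcl_of_mem_closure (one_mem _)
    | mul x y _ _ hx hy => exact mul_mem_topcl hx hy
  intro g hg p hp
  refine hg p ?_
  rintro _ ⟨x, hx, rfl⟩
  exact hcl x hx p hp

lemma IsSemisimpleM.exists_units {S : GL (Fin d) Qbar}
    (hS : IsSemisimpleM (S : Matrix (Fin d) (Fin d) Qbar)) :
    ∃ P : GL (Fin d) Qbar, ∃ D : Fin d → Qbarˣ,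
      (S : Matrix (Fin d) (Fin d) Qbar) = ((P⁻¹ : GL (Fin d) Qbar) : Matrix (Fin d) (Fin d) Qbar) *
        Matrix.diagonal (fun i => (D i : Qbar)) * (P : Matrix (Fin d) (Fin d) Qbar) := by
  obtain ⟨P, D, h⟩ := hS
  have hD : Matrix.diagonal D = ((P * S * P⁻¹ : GL (Fin d) Qbar) : Matrix (Fin d) (Fin d) Qbar) := by
    simp only [Units.val_mul, h, mul_assoc, Units.mul_inv_cancel_left, Units.mul_inv, mul_one]
  have hu : IsUnit D := Matrix.isUnit_diagonal.mp (hD ▸ Units.isUnit _)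
  have hu' : ∀ i, IsUnit (D i) := Pi.isUnit_iff.mp hu
  exact ⟨P, fun i => (hu' i).unit, h⟩

lemma IsSemisimpleM.inv {S : GL (Fin d) Qbar}
    (hS : IsSemisimpleM (S : Matrix (Fin d) (Fin d) Qbar)) :
    IsSemisimpleM ((S⁻¹ : GL (Fin d) Qbar) : Matrix (Fin d) (Fin d) Qbar) := by
  obtain ⟨P, D, h⟩ := hS.exists_units
  refine ⟨P, fun i => ((D i)⁻¹ : Qbarˣ), ?_⟩
  refine Units.inv_eq_of_mul_eq_one_right ?_
  rw [h]
  simp only [mul_assoc, Units.mul_inv_cancel_left]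
  rw [← mul_assoc (Matrix.diagonal _), Matrix.diagonal_mul_diagonal]
  simp

lemma IsUnipotentM.inv {U : GL (Fin d) Qbar}
    (hU : IsUnipotentM (U : Matrix (Fin d) (Fin d) Qbar)) :
    IsUnipotentM ((U⁻¹ : GL (Fin d) Qbar) : Matrix (Fin d) (Fin d) Qbar) := by
  have hcomm : Commute ((U⁻¹ : GL (Fin d) Qbar) : Matrix (Fin d) (Fin d) Qbar)
      ((U : Matrix (Fin d) (Fin d) Qbar) - 1) := by
    refine Commute.sub_right ?_ (Commute.one_right _)
    simp [Commute, SemiconjBy]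
  have h : ((U⁻¹ : GL (Fin d) Qbar) : Matrix (Fin d) (Fin d) Qbar) - 1 =
      -(((U⁻¹ : GL (Fin d) Qbar) : Matrix (Fin d) (Fin d) Qbar) *
        ((U : Matrix (Fin d) (Fin d) Qbar) - 1)) := by
    rw [mul_sub, Units.inv_mul, mul_one, neg_sub]
  rw [IsUnipotentM, h, neg_pow, hcomm.mul_pow, hU, mul_zero, mul_zero]

lemma pow_mul_pow_mem_topcl {S U : GL (Fin d) Qbar} {A : Set (GL (Fin d) Qbar)}
    (hS : IsSemisimpleM (S : Matrix (Fin d) (Fin d) Qbar))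
    (hU : IsUnipotentM (U : Matrix (Fin d) (Fin d) Qbar)) (hSU : Commute S U)
    (hA : S * U ∈ Subgroup.closure A) (m n : ℕ) : S ^ m * U ^ n ∈ topcl A := by
  intro p hp
  obtain ⟨P, D, h⟩ := hS.exists_units
  rw [Units.val_mul, Units.val_pow_eq_pow_val, Units.val_pow_eq_pow_val]
  refine eval_pow_mul_pow_eq_zero P D _ _ h hU p (fun k => ?_) m n
  rw [← Units.val_pow_eq_pow_val, ← Units.val_pow_eq_pow_val, ← Units.val_mul, ← hSU.mul_pow]
  exact hp _ ⟨_, pow_mem hA k, rfl⟩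

lemma left_mem_topcl {S U : GL (Fin d) Qbar} {A : Set (GL (Fin d) Qbar)}
    (hS : IsSemisimpleM (S : Matrix (Fin d) (Fin d) Qbar))
    (hU : IsUnipotentM (U : Matrix (Fin d) (Fin d) Qbar)) (hSU : Commute S U)
    (hA : S * U ∈ Subgroup.closure A) : S ∈ topcl A := by
  simpa using pow_mul_pow_mem_topcl hS hU hSU hA 1 0

lemma right_mem_topcl {S U : GL (Fin d) Qbar} {A : Set (GL (Fin d) Qbar)}
    (hS : IsSemisimpleM (S : Matrix (Fin d) (Fin d) Qbar))
    (hU : IsUnipotentM (U : Matrix (Fin d) (Fin d) Qbar)) (hSU : Commute S U)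
    (hA : S * U ∈ Subgroup.closure A) : U ∈ topcl A := by
  simpa using pow_mul_pow_mem_topcl hS hU hSU hA 0 1

end TopologicalGeneration

/-- For pairwise commuting unipotent `Uᵢ` and semisimple `Sᵢ`:
`cl⟨U₁,…,U_s,S₁,…,S_s⟩ = cl⟨S₁U₁,…,S_sU_s⟩`. -/
theorem stmt8 (d s : ℕ) (U S : Fin s → GL (Fin d) Qbar)
    (hU : ∀ i, IsUnipotentM ((U i : Matrix (Fin d) (Fin d) Qbar)))
    (hS : ∀ i, IsSemisimpleM ((S i : Matrix (Fin d) (Fin d) Qbar)))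
    (hUU : ∀ i j, Commute (U i) (U j))
    (hUS : ∀ i j, Commute (U i) (S j))
    (hSS : ∀ i j, Commute (S i) (S j)) :
    topcl (Set.range U ∪ Set.range S) = topcl (Set.range fun i => S i * U i) := by
  have hmem : ∀ i, S i * U i ∈ Subgroup.closure (Set.range fun i => S i * U i) :=
    fun i => Subgroup.subset_closure ⟨i, rfl⟩
  have hmem' : ∀ i, (S i)⁻¹ * (U i)⁻¹ ∈ Subgroup.closure (Set.range fun i => S i * U i) := by
    intro i
    rw [← _root_.mul_inv_rev, (hUS i i).eq]
    exact inv_mem (hmem i)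
  have hSU : ∀ i, Commute (S i) (U i) := fun i => (hUS i i).symm
  refine Set.Subset.antisymm (topcl_subset_topcl ?_ ?_) (topcl_mono_closure ?_)
  · rintro _ (⟨i, rfl⟩ | ⟨i, rfl⟩)
    · exact right_mem_topcl (hS i) (hU i) (hSU i) (hmem i)
    · exact left_mem_topcl (hS i) (hU i) (hSU i) (hmem i)
  · rintro x (⟨i, hi⟩ | ⟨i, hi⟩)
    · rw [← inv_inv x, ← hi]
      exact right_mem_topcl (hS i).inv (hU i).inv (hSU i).inv_inv (hmem' i)
    · rw [← inv_inv x, ← hi]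
      exact left_mem_topcl (hS i).inv (hU i).inv (hSU i).inv_inv (hmem' i)
  · rintro _ ⟨i, rfl⟩
    exact mul_mem (Subgroup.subset_closure (Or.inr ⟨i, rfl⟩))
      (Subgroup.subset_closure (Or.inl ⟨i, rfl⟩))
end
end

section
/- Let H ⊆ ℚ̄^s be a nonempty Zariski-closed set such that for all t, t' ∈ H and all natural numbers a, b, the vector a·t + b·t' belongs to H. Then H is a ℚ̄-linear subspace of ℚ̄^s. -/
open Matrix MvPolynomial

noncomputable section

/-- A univariate polynomial over a characteristic-zero domain vanishing at every natural number
is zero. -/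
theorem polynomial_eq_zero_of_eval_natCast {R : Type*} [CommRing R] [IsDomain R] [CharZero R]
    (q : Polynomial R) (hq : ∀ n : ℕ, q.eval (n : R) = 0) : q = 0 := by
  refine Polynomial.eq_zero_of_infinite_isRoot q ?_
  refine (Set.infinite_range_of_injective (Nat.cast_injective (R := R))).mono ?_
  rintro _ ⟨n, rfl⟩
  exact hq n

/-- A Zariski-closed set containing all natural multiples of a vector contains all of its
scalar multiples. -/
theorem smul_mem_zcl_of_natCast_smul_mem {ι : Type} [Fintype ι] {E : Set (ι → Qbar)}
    {t : ι → Qbar} (ht : ∀ n : ℕ, (n : Qbar) • t ∈ E) (c : Qbar) : c • t ∈ zcl E := by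
  intro p hp
  have key : ∀ x : Qbar,
      (aeval (fun i => Polynomial.X * Polynomial.C (t i)) p : Polynomial Qbar).eval x =
        eval (x • t) p := by
    intro x
    rw [← Polynomial.coe_evalRingHom, aeval_def, MvPolynomial.hom_eval₂, MvPolynomial.eval]
    change _ = eval₂ _ _ p
    congr 1
    · ext a
      simp
    · ext i
      simpa using mul_comm (t i) x
  have hz := polynomial_eq_zero_of_eval_natCast _ fun n => (key n).trans (hp _ (ht n))
  rw [← key, hz, Polynomial.eval_zero]

/-- A nonempty Zariski-closed subset of `Qbar^s` closed under `ℕ`-combinations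
`a·t + b·t'` is a `Qbar`-linear subspace. -/
theorem stmt13 (s : ℕ) (H : Set (Fin s → Qbar)) (hne : H.Nonempty)
    (hcl : zcl H = H)
    (hadd : ∀ t ∈ H, ∀ t' ∈ H, ∀ a b : ℕ, (a : Qbar) • t + (b : Qbar) • t' ∈ H) :
    ∃ W : Submodule Qbar (Fin s → Qbar), (W : Set (Fin s → Qbar)) = H := by
  obtain ⟨t₀, h₀⟩ := hne
  refine ⟨{ carrier := H, add_mem' := ?_, zero_mem' := ?_, smul_mem' := ?_ }, rfl⟩
  · intro t t' ht ht'
    simpa using hadd t ht t' ht' 1 1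
  · simpa using hadd t₀ h₀ t₀ h₀ 0 0
  · intro c t ht
    change c • t ∈ H
    rw [← hcl]
    exact smul_mem_zcl_of_natCast_smul_mem (fun n => by simpa using hadd t ht t ht n 0) c
end
end

section
/- Let Z := {(x_1,x_2,x_3) ∈ ℚ̄³ : x_1² = x_3² and x_2² = x_3²}, let M ∈ GL_3(ℚ̄) be the matrix with rows (0,−2,0), (2,0,0), (0,0,2), and let v = (1,1,1) ∈ ℚ̄³. Then Z equals the Zariski closure of the orbit {Mⁿv : n ∈ ℤ}. -/
open Matrix MvPolynomial

noncomputable section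

/-- If a polynomial vanishes at the points `16 ^ k • w` for all natural numbers `k`, then it
vanishes on the whole line spanned by `w`. -/
theorem eval_smul_eq_zero_of_forall_pow {ι : Type} (p : MvPolynomial ι Qbar) (w : ι → Qbar)
    (h : ∀ k : ℕ, eval ((16 : Qbar) ^ k • w) p = 0) (s : Qbar) : eval (s • w) p = 0 := by
  set q : Polynomial Qbar :=
    aeval (fun i => Polynomial.X * Polynomial.C (w i) : ι → Polynomial Qbar) p with hq
  have hev (t : Qbar) : q.eval t = eval (t • w) p := by
    rw [hq, ← Polynomial.coe_aeval_eq_eval, ← AlgHom.comp_apply, comp_aeval, aeval_eq_eval]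
    congr 2
    funext i
    simp only [map_mul, Polynomial.aeval_X, Polynomial.aeval_C, Algebra.algebraMap_self,
      RingHom.id_apply, Pi.smul_apply, smul_eq_mul]
  have hinj : Function.Injective (fun k : ℕ => (16 : Qbar) ^ k) := fun a b hab =>
    Nat.pow_right_injective (by norm_num : 2 ≤ 16) (by
      have hab' : (16 : Qbar) ^ a = 16 ^ b := hab
      exact_mod_cast hab')
  have hq0 : q = 0 := Polynomial.eq_zero_of_infinite_isRoot q
    ((Set.infinite_range_of_injective hinj).mono (by
      rintro _ ⟨k, rfl⟩
      exact (hev _).trans (h k)))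
  rw [← hev, hq0, Polynomial.eval_zero]

/-- The scaled rotation generating the orbit. -/
abbrev rotationMatrix : Matrix (Fin 3) (Fin 3) Qbar := !![0, -2, 0; 2, 0, 0; 0, 0, 2]

theorem isUnit_det_rotationMatrix : IsUnit rotationMatrix.det := by
  simp [rotationMatrix, Matrix.det_fin_three]

theorem rotationMatrix_mulVec (y : Fin 3 → Qbar) :
    rotationMatrix *ᵥ y = ![-2 * y 1, 2 * y 0, 2 * y 2] := by
  funext i
  fin_cases i <;> simp [rotationMatrix, Matrix.mulVec, dotProduct, Fin.sum_univ_three]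

theorem rotationMatrix_mulVec_mem_iff (y : Fin 3 → Qbar) :
    ((rotationMatrix *ᵥ y) 0 ^ 2 = (rotationMatrix *ᵥ y) 2 ^ 2 ∧
      (rotationMatrix *ᵥ y) 1 ^ 2 = (rotationMatrix *ᵥ y) 2 ^ 2) ↔
      (y 0 ^ 2 = y 2 ^ 2 ∧ y 1 ^ 2 = y 2 ^ 2) := by
  rw [rotationMatrix_mulVec]
  simp [mul_pow, and_comm]

theorem rotationMatrix_zpow_mulVec_mem (n : ℤ) :
    ((rotationMatrix ^ n) *ᵥ ![1, 1, 1]) 0 ^ 2 = ((rotationMatrix ^ n) *ᵥ ![1, 1, 1]) 2 ^ 2 ∧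
      ((rotationMatrix ^ n) *ᵥ ![1, 1, 1]) 1 ^ 2 =
        ((rotationMatrix ^ n) *ᵥ ![1, 1, 1]) 2 ^ 2 := by
  have step (m : ℤ) : (rotationMatrix ^ (1 + m)) *ᵥ ![1, 1, 1] =
      rotationMatrix *ᵥ ((rotationMatrix ^ m) *ᵥ ![1, 1, 1]) := by
    rw [Matrix.zpow_one_add isUnit_det_rotationMatrix, Matrix.mulVec_mulVec]
  induction n using Int.induction_on with
  | zero => simp
  | succ k ih => rwa [add_comm, step, rotationMatrix_mulVec_mem_iff]
  | pred k ih =>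
    have hk : (-(k : ℤ)) = 1 + (-(k : ℤ) - 1) := by ring
    rwa [hk, step, rotationMatrix_mulVec_mem_iff] at ih

theorem rotationMatrix_pow_four_mul_add_mulVec (k j : ℕ) (v : Fin 3 → Qbar) :
    (rotationMatrix ^ (4 * k + j)) *ᵥ v = (16 : Qbar) ^ k • ((rotationMatrix ^ j) *ᵥ v) := by
  have h2 : rotationMatrix ^ 2 = !![-4, 0, 0; 0, -4, 0; 0, 0, 4] := by
    rw [pow_two, rotationMatrix, Matrix.mul_fin_three]
    norm_num
  have h4 : rotationMatrix ^ 4 = (16 : Qbar) • 1 := by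
    rw [show 4 = 2 * 2 from rfl, pow_mul, h2, pow_two, Matrix.mul_fin_three, Matrix.one_fin_three]
    norm_num
  rw [pow_add, pow_mul, h4, smul_pow, one_pow, smul_mul_assoc, one_mul, Matrix.smul_mulVec]

/-- The variety `x₁² = x₃², x₂² = x₃²` is the orbit closure of `(1,1,1)` under the given
matrix. -/
theorem stmt17 :
    {x : Fin 3 → Qbar | x 0 ^ 2 = x 2 ^ 2 ∧ x 1 ^ 2 = x 2 ^ 2} =
      zcl {x : Fin 3 → Qbar | ∃ n : ℤ,
        x = ((!![0, -2, 0; 2, 0, 0; 0, 0, 2] : Matrix (Fin 3) (Fin 3) Qbar) ^ n).mulVec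
          ![1, 1, 1]} := by
  ext x
  constructor
  · rintro ⟨h0, h1⟩ p hp
    have line (j : ℕ) (s : Qbar) :
        eval (s • ((rotationMatrix ^ j) *ᵥ ![1, 1, 1])) p = 0 := by
      refine eval_smul_eq_zero_of_forall_pow p _ (fun k => hp _ ⟨(4 * k + j : ℕ), ?_⟩) s
      rw [zpow_natCast, rotationMatrix_pow_four_mul_add_mulVec]
    have on_line (j : ℕ) (hx : x = (x 2 / 2 ^ j) • ((rotationMatrix ^ j) *ᵥ ![1, 1, 1])) :
        eval x p = 0 := by
      rw [hx]
      exact line j _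
    rcases sq_eq_sq_iff_eq_or_eq_neg.mp h0 with h0 | h0 <;>
      rcases sq_eq_sq_iff_eq_or_eq_neg.mp h1 with h1 | h1
    on_goal 1 => apply on_line 0
    on_goal 2 => apply on_line 3
    on_goal 3 => apply on_line 1
    on_goal 4 => apply on_line 2
    all_goals
      funext i
      fin_cases i <;>
        simp [pow_succ, h0, h1]
  · intro hx
    have h (i : Fin 3) (hi : ∀ n : ℤ, ((rotationMatrix ^ n) *ᵥ ![1, 1, 1]) i ^ 2 =
        ((rotationMatrix ^ n) *ᵥ ![1, 1, 1]) 2 ^ 2) : x i ^ 2 = x 2 ^ 2 := by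
      have := hx (X i ^ 2 - X 2 ^ 2) (by
        rintro _ ⟨n, rfl⟩
        simpa [sub_eq_zero] using hi n)
      simpa [sub_eq_zero] using this
    exact ⟨h 0 fun n => (rotationMatrix_zpow_mulVec_mem n).1,
      h 1 fun n => (rotationMatrix_zpow_mulVec_mem n).2⟩
end
end

section
/- Let Z := {(x,y) ∈ ℚ̄² : 4x² + y² + 4xy − x − y = 0}, let M ∈ GL_2(ℚ̄) be the matrix with rows (0,−2) and (4,6), and let v = (0,1) ∈ ℚ̄². Then Z equals the Zariski closure of the orbit {Mⁿv : n ∈ ℤ}. -/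
open Matrix MvPolynomial

noncomputable section

/-- The orbit of `(0,1)` lies on the curve parametrised by `t ↦ (t - t², 2t² - t)`, at the
parameters `t = 2ⁿ`. -/
theorem orbit_eq_param (n : ℤ) :
    ((!![0, -2; 4, 6] : Matrix (Fin 2) (Fin 2) Qbar) ^ n).mulVec ![0, 1] =
      ![2 ^ n - (2 ^ n) ^ 2, 2 * (2 ^ n) ^ 2 - 2 ^ n] := by
  have hdet : IsUnit (!![0, -2; 4, 6] : Matrix (Fin 2) (Fin 2) Qbar).det := by
    rw [Matrix.det_fin_two_of, isUnit_iff_ne_zero]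
    norm_num
  have step (m : ℤ) : (!![0, -2; 4, 6] : Matrix (Fin 2) (Fin 2) Qbar).mulVec
      ![2 ^ m - (2 ^ m) ^ 2, 2 * (2 ^ m) ^ 2 - 2 ^ m] =
      ![2 ^ (m + 1) - (2 ^ (m + 1)) ^ 2, 2 * (2 ^ (m + 1)) ^ 2 - 2 ^ (m + 1)] := by
    rw [zpow_add_one₀ (two_ne_zero : (2 : Qbar) ≠ 0)]
    ext i
    fin_cases i <;> simp [Matrix.mulVec, dotProduct, Fin.sum_univ_two] <;> ring
  induction n with
  | zero =>
    ext i
    fin_cases i <;> norm_num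
  | succ k ih => rw [add_comm, Matrix.zpow_one_add hdet, ← Matrix.mulVec_mulVec, ih, step, add_comm]
  | pred k ih =>
    have h := step (-(k : ℤ) - 1)
    rw [sub_add_cancel, ← ih] at h
    rw [show -(k : ℤ) - 1 = -1 + -k by ring] at h ⊢
    rw [Matrix.zpow_add hdet, Matrix.zpow_neg_one, ← Matrix.mulVec_mulVec, ← h,
      Matrix.mulVec_mulVec, Matrix.nonsing_inv_mul _ hdet, Matrix.one_mulVec]

/-- A polynomial in two variables that vanishes at the points `(t - t², 2t² - t)` with `t = 2ⁿ`
vanishes at all points of that form. -/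
theorem eval_param_eq_zero (p : MvPolynomial (Fin 2) Qbar)
    (h : ∀ n : ℕ, eval ![(2 : Qbar) ^ n - (2 ^ n) ^ 2, 2 * (2 ^ n) ^ 2 - 2 ^ n] p = 0)
    (t : Qbar) : eval ![t - t ^ 2, 2 * t ^ 2 - t] p = 0 := by
  let q : Polynomial Qbar :=
    aeval ![Polynomial.X - Polynomial.X ^ 2, 2 * Polynomial.X ^ 2 - Polynomial.X] p
  have hq (s : Qbar) : q.eval s = eval ![s - s ^ 2, 2 * s ^ 2 - s] p := by
    rw [← Polynomial.coe_aeval_eq_eval, ← MvPolynomial.coe_aeval_eq_eval]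
    change ((Polynomial.aeval s).comp (aeval _)) p = aeval _ p
    congr 1
    ext i
    fin_cases i <;> simp
  have hinj : Function.Injective fun n : ℕ => (2 : Qbar) ^ n := by
    intro a b hab
    have hab' : (2 : Qbar) ^ a = 2 ^ b := hab
    exact Nat.pow_right_injective le_rfl (by exact_mod_cast hab')
  have hzero : q = 0 := Polynomial.eq_zero_of_infinite_isRoot q <|
    (Set.infinite_range_of_injective hinj).mono <| by
      rintro _ ⟨n, rfl⟩
      exact (hq _).trans (h n)
  rw [← hq, hzero, Polynomial.eval_zero]

/-- The variety `4x² + y² + 4xy − x − y = 0` is the orbit closure of `(0,1)` under the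
given matrix. -/
theorem stmt18 :
    {p : Fin 2 → Qbar |
        4 * p 0 ^ 2 + p 1 ^ 2 + 4 * p 0 * p 1 - p 0 - p 1 = 0} =
      zcl {x : Fin 2 → Qbar | ∃ n : ℤ,
        x = ((!![0, -2; 4, 6] : Matrix (Fin 2) (Fin 2) Qbar) ^ n).mulVec ![0, 1]} := by
  ext x
  constructor
  · intro hx p hp
    have hx' : 4 * x 0 ^ 2 + x 1 ^ 2 + 4 * x 0 * x 1 - x 0 - x 1 = 0 := hx
    have hparam : x = ![(2 * x 0 + x 1) - (2 * x 0 + x 1) ^ 2,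
        2 * (2 * x 0 + x 1) ^ 2 - (2 * x 0 + x 1)] := by
      ext i
      fin_cases i
      · simp only [Fin.zero_eta, Matrix.cons_val_zero]
        linear_combination hx'
      · simp only [Fin.mk_one, Matrix.cons_val_one, Matrix.cons_val_fin_one]
        linear_combination -2 * hx'
    rw [hparam]
    exact eval_param_eq_zero p
      (fun n => hp _ ⟨n, by simpa using (orbit_eq_param n).symm⟩) _
  · intro hx
    have h := hx (4 * X 0 ^ 2 + X 1 ^ 2 + 4 * X 0 * X 1 - X 0 - X 1) (by
      rintro _ ⟨n, rfl⟩
      rw [orbit_eq_param]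
      simp
      ring)
    simpa using h
end
end
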